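/- arXiv:2410.09789 — 5 statements merged into one kernel-verified Lean document; each statement's English description precedes it below -/
import Mathlib

section
/- Let I ⊆ ℝ be a nonempty open interval and let q : ℝ → ℝ be strictly increasing on I and a dc function on I. Then for every nonempty open subinterval (a,b) ⊆ I there exist points d, c with a < d < c < b such that the left derivative of q is strictly positive at every point of the closed interval [d,c]. -/
open Set Filter Topology

/-- The left derivative of a convex function is left continuous. -/
lemma ConvexOn.continuousWithinAt_leftDeriv {S : Set ℝ} {f : ℝ → ℝ} {x : ℝ}
    (hf : ConvexOn ℝ S f) (hx : x ∈ interior S) :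
    ContinuousWithinAt (fun y ↦ derivWithin f (Iio y) y) (Iic x) x := by
  rw [← continuousWithinAt_Iio_iff_Iic]
  have hint : ∀ᶠ y in 𝓝[<] x, y ∈ interior S :=
    mem_nhdsWithin_of_mem_nhds (isOpen_interior.mem_nhds hx)
  refine tendsto_order.2 ⟨fun c hc ↦ ?_, fun c hc ↦ ?_⟩
  · have hslope := (hasDerivWithinAt_iff_tendsto_slope' self_notMem_Iio).1
      (hf.hasDerivWithinAt_leftDeriv_of_mem_interior hx)
    obtain ⟨y, hcy, hyS, hyx⟩ :=
      ((hslope.eventually_const_lt hc).and (hint.and self_mem_nhdsWithin)).exists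
    have hcont : ContinuousAt (slope f y) x := by
      have hfx : ContinuousAt f x :=
        hf.continuousOn_interior.continuousAt (isOpen_interior.mem_nhds hx)
      rw [slope_fun_def_field]
      exact (hfx.sub continuousAt_const).div (continuousAt_id.sub continuousAt_const)
        (sub_ne_zero.2 hyx.ne')
    rw [slope_comm] at hcy
    filter_upwards [hint, mem_nhdsWithin_of_mem_nhds (hcont.eventually_const_lt hcy),
      mem_nhdsWithin_of_mem_nhds (Ioi_mem_nhds hyx)] with z hzS hcz hyz
    exact hcz.trans_le (hf.slope_le_leftDeriv_of_mem_interior (interior_subset hyS) hzS hyz)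
  · filter_upwards [hint, self_mem_nhdsWithin] with z hzS hzx
    exact (hf.monotoneOn_leftDeriv hzS hx (le_of_lt hzx)).trans_lt hc

/-- A continuous function with nonpositive left derivative on `(a, b]` satisfies `q b ≤ q a`. -/
lemma le_of_hasDerivWithinAt_Iio_nonpos {q q' : ℝ → ℝ} {a b : ℝ} (hab : a ≤ b)
    (hq : ContinuousOn q (Icc a b))
    (hq' : ∀ x ∈ Ioc a b, HasDerivWithinAt q (q' x) (Iio x) x)
    (hnonpos : ∀ x ∈ Ioc a b, q' x ≤ 0) : q b ≤ q a := by
  have hneg : ∀ t ∈ Ico (-b) (-a), -t ∈ Ioc a b := fun t ht ↦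
    ⟨by linarith [ht.2], by linarith [ht.1]⟩
  have hbound := image_le_of_deriv_right_le_deriv_boundary (f := fun _ ↦ q b) (f' := fun _ ↦ 0)
    (B := fun t ↦ q (-t)) (B' := fun t ↦ -q' (-t)) (a := -b) (b := -a)
    continuousOn_const (fun _ _ ↦ hasDerivWithinAt_const ..) (by simp)
    (hq.comp continuousOn_neg fun t ht ↦ ⟨by linarith [ht.2], by linarith [ht.1]⟩)
    (fun t ht ↦ by
      have h := ((hq' (-t) (hneg t ht)).Iic_of_Iio).scomp (h := fun t ↦ -t) t
        (hasDerivWithinAt_neg t (Ici t)) (fun s hs ↦ neg_le_neg (mem_Ici.1 hs))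
      simpa [Function.comp_def] using h)
    (fun t ht ↦ neg_nonneg.2 (hnonpos _ (hneg t ht)))
  simpa using hbound (right_mem_Icc.2 (neg_le_neg hab))


/-- If `I` is a nonempty open interval of `ℝ` and `q` is strictly increasing
and a dc function on `I`, then every nonempty open subinterval `(a,b) ⊆ I` contains
points `a < d < c < b` such that the left derivative of `q` is strictly positive on `[d,c]`. -/
theorem dc_strictMono_left_deriv_pos_on_subinterval
    (I : Set ℝ) (hI_open : IsOpen I) (hI_conn : I.OrdConnected) (hI_ne : I.Nonempty)
    (q : ℝ → ℝ) (hmono : StrictMonoOn q I)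
    (hdc : ∃ g h : ℝ → ℝ, ConvexOn ℝ I g ∧ ConvexOn ℝ I h ∧ ∀ x ∈ I, q x = g x - h x) :
    ∀ a b : ℝ, a < b → Set.Ioo a b ⊆ I →
      ∃ d c : ℝ, a < d ∧ d < c ∧ c < b ∧
        ∀ x ∈ Set.Icc d c, 0 < derivWithin q (Set.Iio x) x := by
  obtain ⟨g, h, hg, hh, hqgh⟩ := hdc
  intro a b hab hsub
  have hint : ∀ x ∈ I, x ∈ interior I := fun x hx ↦ hI_open.interior_eq.symm ▸ hx
  have hderiv : ∀ x ∈ I, HasDerivWithinAt q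
      (derivWithin g (Iio x) x - derivWithin h (Iio x) x) (Iio x) x := fun x hx ↦
    ((hg.hasDerivWithinAt_leftDeriv_of_mem_interior (hint x hx)).sub
      (hh.hasDerivWithinAt_leftDeriv_of_mem_interior (hint x hx))).congr_of_eventuallyEq
      (mem_nhdsWithin_of_mem_nhds (mem_of_superset (hI_open.mem_nhds hx) hqgh)) (hqgh x hx)
  have hcont : ContinuousOn q I :=
    ((hg.continuousOn hI_open).sub (hh.continuousOn hI_open)).congr hqgh
  obtain ⟨u, hau, hub⟩ := exists_between hab
  obtain ⟨v, huv, hvb⟩ := exists_between hub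
  have huvI : Icc u v ⊆ I := fun x hx ↦ hsub ⟨hau.trans_le hx.1, hx.2.trans_lt hvb⟩
  obtain ⟨c, hc, hcpos⟩ : ∃ c ∈ Ioc u v,
      0 < derivWithin g (Iio c) c - derivWithin h (Iio c) c := by
    by_contra! hnonpos
    exact (hmono (huvI (left_mem_Icc.2 huv.le)) (huvI (right_mem_Icc.2 huv.le)) huv).not_ge
      (le_of_hasDerivWithinAt_Iio_nonpos huv.le (hcont.mono huvI)
        (fun x hx ↦ hderiv x (huvI (Ioc_subset_Icc_self hx))) hnonpos)
  have hcI := hint c (huvI (Ioc_subset_Icc_self hc))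
  have hpos : ∀ᶠ x in 𝓝[≤] c, 0 < derivWithin g (Iio x) x - derivWithin h (Iio x) x :=
    ((hg.continuousWithinAt_leftDeriv hcI).sub
      (hh.continuousWithinAt_leftDeriv hcI)).eventually_const_lt hcpos
  obtain ⟨l, hlc, hl⟩ := (mem_nhdsLE_iff_exists_Ioc_subset' hc.1).1 hpos
  obtain ⟨d, hd, hdc⟩ := exists_between (max_lt hlc hc.1)
  obtain ⟨hld, hud⟩ := max_lt_iff.1 hd
  refine ⟨d, c, hau.trans hud, hdc, hc.2.trans_lt hvb, fun x hx ↦ ?_⟩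
  rw [(hderiv x (huvI ⟨hud.le.trans hx.1, hx.2.trans hc.2⟩)).derivWithin
    (uniqueDiffWithinAt_Iio x)]
  exact hl ⟨hld.trans_le hx.1, hx.2⟩
end

section
/- Let f : (0,∞) → (0,∞) be continuous with f(2^{-n}) = n·2^n for every integer n ≥ 1, and assume ∫₀^ε f(x) dx < ∞ for some ε ∈ (0,∞). Define s : ℝ → ℝ by s(x) = ∫₀^x f(|y|) dy. Then s is continuous and strictly increasing, but s is not a dc function on any open interval containing 0; in particular, there do not exist convex functions g, h : ℝ → ℝ with s = g − h. -/
open MeasureTheory Set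

/-- The composition of a function with `|·|` is interval integrable as soon as the function is
continuous on `(0, ∞)` and integrable near `0`. -/
theorem intervalIntegrable_comp_abs {f : ℝ → ℝ} (hf_cont : ContinuousOn f (Ioi (0 : ℝ)))
    (hf_int : ∃ ε : ℝ, 0 < ε ∧ IntegrableOn f (Ioo (0 : ℝ) ε) volume) (a b : ℝ) :
    IntervalIntegrable (fun y => f |y|) volume a b := by
  obtain ⟨ε, hε, hint⟩ := hf_int
  refine intervalIntegrable_of_even (fun x => by simp) fun x hx => ?_
  have h_left : IntervalIntegrable f volume 0 ε :=
    (intervalIntegrable_iff_integrableOn_Ioo_of_le hε.le).2 hint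
  have h_right : IntervalIntegrable f volume ε x :=
    (hf_cont.mono fun y hy => (lt_min hε hx).trans_le hy.1).intervalIntegrable
  refine (h_left.trans h_right).congr_uIoo fun y hy => ?_
  rw [uIoo_of_lt hx] at hy
  simp [abs_of_pos hy.1]

theorem hasDerivAt_integral_comp_abs {f : ℝ → ℝ} (hf_cont : ContinuousOn f (Ioi (0 : ℝ)))
    (hf_int : ∃ ε : ℝ, 0 < ε ∧ IntegrableOn f (Ioo (0 : ℝ) ε) volume) {x : ℝ} (hx : x ≠ 0) :
    HasDerivAt (fun t => ∫ y in (0 : ℝ)..t, f |y|) (f |x|) x := by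
  have h_cont : ContinuousOn (fun y => f |y|) ({0}ᶜ : Set ℝ) :=
    hf_cont.comp continuous_abs.continuousOn fun y hy => abs_pos.2 hy
  exact intervalIntegral.integral_hasDerivAt_right (intervalIntegrable_comp_abs hf_cont hf_int 0 x)
    (h_cont.stronglyMeasurableAtFilter isOpen_compl_singleton x hx)
    (h_cont.continuousAt (isOpen_compl_singleton.mem_nhds hx))

/-- A difference of two convex functions on an open set is Lipschitz near each of its points. -/
theorem exists_lipschitzOnWith_of_eq_sub_convexOn {s g h : ℝ → ℝ} {U : Set ℝ} (hU : IsOpen U)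
    (hg : ConvexOn ℝ U g) (hh : ConvexOn ℝ U h) (hs : ∀ x ∈ U, s x = g x - h x)
    {x : ℝ} (hx : x ∈ U) : ∃ K, ∃ V ∈ nhds x, LipschitzOnWith K s V := by
  obtain ⟨Kg, Vg, hVg, hLg⟩ := hg.locallyLipschitzOn hU hx
  obtain ⟨Kh, Vh, hVh, hLh⟩ := hh.locallyLipschitzOn hU hx
  rw [hU.nhdsWithin_eq hx] at hVg hVh
  refine ⟨Kg + Kh, U ∩ (Vg ∩ Vh),
    Filter.inter_mem (hU.mem_nhds hx) (Filter.inter_mem hVg hVh), ?_⟩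
  have h_sub := (hLg.mono (inter_subset_left (t := Vh))).sub (hLh.mono inter_subset_right)
  intro y hy z hz
  rw [hs y hy.1, hs z hz.1]
  exact h_sub hy.2 hz.2

/-- If `f : (0,∞) → (0,∞)` is continuous with `f (2⁻ⁿ) = n·2ⁿ` and is
integrable near `0`, then `s x = ∫₀ˣ f |y| dy` is continuous and strictly increasing,
but `s` is not a dc function on any open interval containing `0`; in particular `s` is
not the difference of two convex functions on `ℝ`. -/
theorem scale_function_not_dc
    (f : ℝ → ℝ) (hf_cont : ContinuousOn f (Ioi (0 : ℝ)))
    (hf_pos : ∀ x : ℝ, 0 < x → 0 < f x)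
    (hf_dyadic : ∀ n : ℕ, 1 ≤ n → f ((2 : ℝ) ^ (-(n : ℤ))) = (n : ℝ) * 2 ^ n)
    (hf_int : ∃ ε : ℝ, 0 < ε ∧ IntegrableOn f (Ioo (0 : ℝ) ε) volume)
    (s : ℝ → ℝ) (hs : ∀ x : ℝ, s x = ∫ y in (0 : ℝ)..x, f |y|) :
    Continuous s ∧ StrictMono s ∧
    (∀ U : Set ℝ, IsOpen U → U.OrdConnected → (0 : ℝ) ∈ U →
      ¬ ∃ g h : ℝ → ℝ, ConvexOn ℝ U g ∧ ConvexOn ℝ U h ∧ ∀ x ∈ U, s x = g x - h x) ∧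
    (¬ ∃ g h : ℝ → ℝ, ConvexOn ℝ univ g ∧ ConvexOn ℝ univ h ∧ ∀ x : ℝ, s x = g x - h x) := by
  have h_deriv {x : ℝ} (hx : x ≠ 0) : HasDerivAt s (f |x|) x := by
    rw [funext hs]
    exact hasDerivAt_integral_comp_abs hf_cont hf_int hx
  have h_cont : Continuous s := by
    rw [funext hs]
    exact intervalIntegral.continuous_primitive (intervalIntegrable_comp_abs hf_cont hf_int) 0
  have h_pos {x : ℝ} (hx : x ≠ 0) : 0 < deriv s x := by
    rw [(h_deriv hx).deriv]
    exact hf_pos _ (abs_pos.2 hx)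
  have h_not_dc (U : Set ℝ) (hU : IsOpen U) (h0 : (0 : ℝ) ∈ U) :
      ¬ ∃ g h : ℝ → ℝ, ConvexOn ℝ U g ∧ ConvexOn ℝ U h ∧ ∀ x ∈ U, s x = g x - h x := by
    rintro ⟨g, h, hg, hh, hgh⟩
    obtain ⟨K, V, hV, hK⟩ := exists_lipschitzOnWith_of_eq_sub_convexOn hU hg hh hgh h0
    have h_tendsto : Filter.Tendsto (fun n : ℕ => (2 : ℝ) ^ (-(n : ℤ))) Filter.atTop (nhds 0) := by
      simpa using tendsto_pow_atTop_nhds_zero_of_lt_one (r := (2 : ℝ)⁻¹) (by norm_num) (by norm_num)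
    obtain ⟨n, hnV, hn1, hnK⟩ := ((h_tendsto.eventually (eventually_mem_nhds_iff.2 hV)).and
      ((Filter.eventually_ge_atTop 1).and
        (tendsto_natCast_atTop_atTop.eventually_gt_atTop (K : ℝ)))).exists
    have h_xpos : (0 : ℝ) < 2 ^ (-(n : ℤ)) := by positivity
    have h_le := (h_deriv h_xpos.ne').le_of_lipschitzOn hnV hK
    rw [abs_of_pos h_xpos, hf_dyadic n hn1, Real.norm_of_nonneg (by positivity)] at h_le
    have h_two : (1 : ℝ) ≤ 2 ^ n := one_le_pow₀ (by norm_num)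
    nlinarith [(Nat.cast_nonneg n : (0 : ℝ) ≤ n)]
  refine ⟨h_cont, ?_, fun U hU _ h0 => h_not_dc U hU h0, fun ⟨g, h, hg, hh, hgh⟩ =>
    h_not_dc univ isOpen_univ (mem_univ 0) ⟨g, h, hg, hh, fun x _ => hgh x⟩⟩
  refine StrictMonoOn.Iic_union_Ici (a := 0)
    (strictMonoOn_of_deriv_pos (convex_Iic 0) h_cont.continuousOn fun x hx => h_pos ?_)
    (strictMonoOn_of_deriv_pos (convex_Ici 0) h_cont.continuousOn fun x hx => h_pos ?_)
  · rw [interior_Iic] at hx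
    exact hx.ne
  · rw [interior_Ici] at hx
    exact hx.ne'
end

section
/- Let h : (0,1/2] → ℝ satisfy 0 ≤ h(x) ≤ x·(log₂ x)² for all x ∈ (0,1/2], and suppose that for every integer n ≥ 1 there exists c_n ∈ [2^{-n-1}, 2^{-n}] such that h is nondecreasing on [2^{-n-1}, c_n] and nonincreasing on [c_n, 2^{-n}]. Then the extension of h to [0,1/2] obtained by setting h(0) = 0 has bounded variation on [0,1/2]. -/
open Set

theorem eVariationOn_Icc_eq_sum_of_antitone {α E : Type*} [LinearOrder α] [PseudoEMetricSpace E]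
    (f : α → E) {a : ℕ → α} (ha : Antitone a) (n : ℕ) :
    eVariationOn f (Icc (a n) (a 0)) =
      ∑ i ∈ Finset.range n, eVariationOn f (Icc (a (i + 1)) (a i)) := by
  induction n with
  | zero => simp
  | succ n ih =>
    rw [Finset.sum_range_succ, ← ih, add_comm (eVariationOn _ _)]
    simpa using (eVariationOn.Icc_add_Icc f (s := univ) (ha n.le_succ) (ha n.zero_le)
      (mem_univ _)).symm

theorem eVariationOn_Icc_le_tsum_of_antitone {α E : Type*} [LinearOrder α] [DenselyOrdered α]
    [TopologicalSpace α] [OrderTopology α] [PseudoEMetricSpace E]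
    {f : α → E} {a : ℕ → α} {l : α} (ha : Antitone a) (hl : Filter.Tendsto a .atTop (nhds l))
    (hf : ContinuousWithinAt f (Ici l) l) :
    eVariationOn f (Icc l (a 0)) ≤ ∑' i, eVariationOn f (Icc (a (i + 1)) (a i)) := by
  rw [← eVariationOn.eVariationOn_Ioc_eq_Icc_of_continuousWithinAt hf, eVariationOn.eq_biSup_inter_Icc]
  refine iSup₂_le fun p hp => ?_
  obtain ⟨n, hn⟩ := (hl.eventually_lt_const hp.1.1).exists
  calc eVariationOn f (Ioc l (a 0) ∩ Icc p.1 p.2)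
      ≤ eVariationOn f (Icc (a n) (a 0)) :=
        eVariationOn.mono f fun x hx => ⟨hn.le.trans hx.2.1, hx.1.2⟩
    _ = ∑ i ∈ Finset.range n, eVariationOn f (Icc (a (i + 1)) (a i)) :=
        eVariationOn_Icc_eq_sum_of_antitone f ha n
    _ ≤ _ := ENNReal.sum_le_tsum _

theorem AntitoneOn.eVariationOn_eq {α : Type*} [LinearOrder α] {f : α → ℝ} {s : Set α} {a b : α}
    (hf : AntitoneOn f s) (as : a ∈ s) (bs : b ∈ s) :
    eVariationOn f (s ∩ Icc a b) = ENNReal.ofReal (f a - f b) := by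
  rw [← eVariationOn.comp_ofDual f, preimage_inter, ← Icc_toDual]
  exact hf.dual_left.eVariationOn_eq bs as

theorem eVariationOn_Icc_le_of_unimodal {α : Type*} [LinearOrder α] {f : α → ℝ} {a b c : α}
    (hc : c ∈ Icc a b) (hmono : MonotoneOn f (Icc a c)) (hanti : AntitoneOn f (Icc c b))
    (ha : 0 ≤ f a) (hb : 0 ≤ f b) :
    eVariationOn f (Icc a b) ≤ ENNReal.ofReal (2 * f c) := by
  have hsplit := eVariationOn.Icc_add_Icc f (s := univ) hc.1 hc.2 (mem_univ _)
  simp only [univ_inter] at hsplit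
  have h₁ : eVariationOn f (Icc a c) ≤ ENNReal.ofReal (f c) := by
    rw [← inter_self (Icc a c),
      hmono.eVariationOn_eq (left_mem_Icc.2 hc.1) (right_mem_Icc.2 hc.1)]
    exact ENNReal.ofReal_le_ofReal (by linarith)
  have h₂ : eVariationOn f (Icc c b) ≤ ENNReal.ofReal (f c) := by
    rw [← inter_self (Icc c b),
      hanti.eVariationOn_eq (left_mem_Icc.2 hc.2) (right_mem_Icc.2 hc.2)]
    exact ENNReal.ofReal_le_ofReal (by linarith)
  have hfc : 0 ≤ f c := ha.trans (hmono (left_mem_Icc.2 hc.1) (right_mem_Icc.2 hc.1) hc.1)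
  rw [← hsplit, two_mul, ENNReal.ofReal_add hfc hfc]
  exact add_le_add h₁ h₂

theorem tendsto_mul_logb_sq_nhdsGT_zero (b : ℝ) :
    Filter.Tendsto (fun x => x * Real.logb b x ^ 2) (nhdsWithin 0 (Ioi 0)) (nhds 0) := by
  have h := (((tendsto_log_mul_rpow_nhdsGT_zero (half_pos one_pos)).pow 2).div_const
    (Real.log b ^ 2))
  simp only [ne_eq, OfNat.ofNat_ne_zero, not_false_eq_true, zero_pow, zero_div] at h
  refine h.congr' (Filter.eventually_of_mem self_mem_nhdsWithin fun x hx => ?_)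
  simp only [← Real.sqrt_eq_rpow, mul_pow, Real.sq_sqrt (le_of_lt hx), Real.logb, div_pow]
  ring

theorem mul_logb_two_sq_le_of_mem_dyadic {n : ℕ} {x : ℝ}
    (hx : x ∈ Icc ((1 / 2 : ℝ) ^ (n + 1)) ((1 / 2) ^ n)) :
    x * Real.logb 2 x ^ 2 ≤ (1 / 2) ^ n * (n + 1) ^ 2 := by
  have hpow (k : ℕ) : Real.logb 2 ((1 / 2 : ℝ) ^ k) = -k := by
    rw [Real.logb_pow, one_div, Real.logb_inv, Real.logb_self_eq_one one_lt_two]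
    ring
  have hx₀ : 0 < x := lt_of_lt_of_le (by positivity) hx.1
  have hlow := Real.logb_le_logb_of_le one_lt_two (by positivity) hx.1
  have hupp := Real.logb_le_logb_of_le one_lt_two hx₀ hx.2
  rw [hpow] at hlow hupp
  push_cast at hlow
  have : (0 : ℝ) ≤ n := n.cast_nonneg
  exact mul_le_mul hx.2 (by nlinarith) (sq_nonneg _) (by positivity)

theorem summable_half_pow_mul_add_one_sq :
    Summable fun n : ℕ => (1 / 2 : ℝ) ^ n * (n + 1) ^ 2 := by
  have h := ((summable_nat_add_iff 1).2 (summable_pow_mul_geometric_of_norm_lt_one 2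
    (r := (1 / 2 : ℝ)) (by norm_num))).mul_left 2
  refine h.congr fun n => ?_
  push_cast
  ring

/-- If `0 ≤ h x ≤ x·(log₂ x)²` on `(0,1/2]` and `h` is unimodal
(first nondecreasing, then nonincreasing) on each dyadic interval `[2^{-n-1}, 2^{-n}]`,
then the extension of `h` by `h 0 = 0` has bounded variation on `[0,1/2]`. -/
theorem bounded_variation_of_dyadic_unimodal
    (h : ℝ → ℝ)
    (h_bnd : ∀ x : ℝ, 0 < x → x ≤ 1 / 2 → 0 ≤ h x ∧ h x ≤ x * (Real.logb 2 x) ^ 2)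
    (h_uni : ∀ n : ℕ, 1 ≤ n → ∃ c ∈ Icc ((2 : ℝ) ^ (-(n : ℤ) - 1)) ((2 : ℝ) ^ (-(n : ℤ))),
      MonotoneOn h (Icc ((2 : ℝ) ^ (-(n : ℤ) - 1)) c) ∧
      AntitoneOn h (Icc c ((2 : ℝ) ^ (-(n : ℤ))))) :
    BoundedVariationOn (fun x => if x = 0 then 0 else h x) (Icc (0 : ℝ) (1 / 2)) := by
  set f : ℝ → ℝ := fun x => if x = 0 then 0 else h x
  have hfh {x : ℝ} (hx : 0 < x) : f x = h x := if_neg hx.ne'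
  have hcont : ContinuousWithinAt f (Ici 0) 0 := by
    rw [← continuousWithinAt_Ioi_iff_Ici, ContinuousWithinAt, show f 0 = 0 from if_pos rfl]
    have hmem : Ioc (0 : ℝ) (1 / 2) ∈ nhdsWithin (0 : ℝ) (Ioi 0) :=
      Ioc_mem_nhdsGT (by norm_num)
    refine tendsto_of_tendsto_of_tendsto_of_le_of_le' tendsto_const_nhds
      (tendsto_mul_logb_sq_nhdsGT_zero 2) ?_ ?_ <;>
      filter_upwards [hmem] with x hx
    · rw [hfh hx.1]
      exact (h_bnd x hx.1 hx.2).1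
    · rw [hfh hx.1]
      exact (h_bnd x hx.1 hx.2).2
  have hpos (n : ℕ) : (0 : ℝ) < (1 / 2) ^ n := by positivity
  have hanti : Antitone fun n : ℕ => (1 / 2 : ℝ) ^ n :=
    pow_right_anti₀ (by norm_num) (by norm_num)
  have hle (n : ℕ) : (1 / 2 : ℝ) ^ (n + 1) ≤ 1 / 2 := by
    simpa using hanti (Nat.le_add_left 1 n)
  have hdyadic (n : ℕ) : eVariationOn f (Icc ((1 / 2) ^ (n + 1 + 1)) ((1 / 2) ^ (n + 1))) ≤
      ENNReal.ofReal (2 * ((1 / 2) ^ (n + 1) * ((n + 1 : ℕ) + 1) ^ 2)) := by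
    have hr : (2 : ℝ) ^ (-((n + 1 : ℕ) : ℤ)) = (1 / 2) ^ (n + 1) := by
      rw [zpow_neg, zpow_natCast, one_div, inv_pow]
    have hl : (2 : ℝ) ^ (-((n + 1 : ℕ) : ℤ) - 1) = (1 / 2) ^ (n + 1 + 1) := by
      rw [zpow_sub_one₀ two_ne_zero, hr, pow_succ _ (n + 1), one_div]
    obtain ⟨c, hc, hm, ha⟩ := h_uni (n + 1) (Nat.le_add_left 1 n)
    rw [hl] at hc hm
    rw [hr] at hc ha
    have hc₀ : 0 < c := (hpos _).trans_le hc.1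
    have hnonneg (k : ℕ) : 0 ≤ h ((1 / 2) ^ (k + 1)) := (h_bnd _ (hpos _) (hle k)).1
    rw [eVariationOn.congr (g := h) fun x hx => hfh ((hpos _).trans_le hx.1)]
    refine (eVariationOn_Icc_le_of_unimodal hc hm ha (hnonneg _) (hnonneg _)).trans
      (ENNReal.ofReal_le_ofReal ?_)
    have := (h_bnd c hc₀ (hc.2.trans (hle n))).2
    linarith [mul_logb_two_sq_le_of_mem_dyadic hc]
  have hsum := ((summable_nat_add_iff 1).2 summable_half_pow_mul_add_one_sq).mul_left 2
  have hlim : Filter.Tendsto (fun n : ℕ => (1 / 2 : ℝ) ^ (n + 1)) .atTop (nhds 0) :=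
    (Filter.tendsto_add_atTop_iff_nat 1).2
      (tendsto_pow_atTop_nhds_zero_of_lt_one (by norm_num) (by norm_num))
  have hvar := eVariationOn_Icc_le_tsum_of_antitone (a := fun n : ℕ => (1 / 2 : ℝ) ^ (n + 1))
    (fun i j hij => hanti (Nat.succ_le_succ hij)) hlim hcont
  simp only [zero_add, pow_one] at hvar
  exact ne_top_of_le_ne_top hsum.tsum_ofReal_ne_top (hvar.trans (ENNReal.tsum_le_tsum hdyadic))
end

section
/- Let q : ℝ → ℝ be differentiable at every point, and suppose its derivative q' has bounded variation on every compact interval [a,b] ⊆ ℝ. Then q is a dc function on ℝ: there exist convex functions g, h : ℝ → ℝ with q = g − h. -/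
open Set

/-- A primitive of a monotone function is convex. -/
theorem Monotone.convexOn_univ_integral {p : ℝ → ℝ} (hp : Monotone p) (a : ℝ) :
    ConvexOn ℝ univ (fun x => ∫ t in a..x, p t) := by
  have hint (x y : ℝ) : IntervalIntegrable p MeasureTheory.volume x y := hp.intervalIntegrable
  refine convexOn_of_slope_mono_adjacent convex_univ fun {x y z} _ _ hxy hyz => ?_
  rw [intervalIntegral.integral_interval_sub_left (hint _ _) (hint _ _),
    intervalIntegral.integral_interval_sub_left (hint _ _) (hint _ _)]
  have h₁ : (∫ t in x..y, p t) ≤ ∫ _ in x..y, p y :=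
    intervalIntegral.integral_mono_on hxy.le (hint _ _) intervalIntegrable_const
      fun t ht => hp ht.2
  have h₂ : (∫ _ in y..z, p y) ≤ ∫ t in y..z, p t :=
    intervalIntegral.integral_mono_on hyz.le intervalIntegrable_const (hint _ _)
      fun t ht => hp ht.1
  rw [intervalIntegral.integral_const, smul_eq_mul] at h₁ h₂
  refine le_trans (b := p y) ?_ ?_
  · rw [div_le_iff₀ (sub_pos.2 hxy)]
    linarith
  · rw [le_div_iff₀ (sub_pos.2 hyz)]
    linarith

/-- If `q : ℝ → ℝ` is everywhere differentiable and its derivative has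
bounded variation on every compact interval, then `q` is a dc function on `ℝ`. -/
theorem dc_of_deriv_locally_bounded_variation
    (q : ℝ → ℝ) (hq : Differentiable ℝ q)
    (hbv : ∀ a b : ℝ, BoundedVariationOn (deriv q) (Icc a b)) :
    ∃ g h : ℝ → ℝ, ConvexOn ℝ univ g ∧ ConvexOn ℝ univ h ∧ ∀ x : ℝ, q x = g x - h x := by
  have hloc : LocallyBoundedVariationOn (deriv q) univ :=
    fun a b _ _ => (hbv a b).mono inter_subset_right
  obtain ⟨p, r, hp, hr, hpr⟩ := hloc.exists_monotoneOn_sub_monotoneOn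
  rw [monotoneOn_univ] at hp hr
  refine ⟨fun x => (∫ t in (0 : ℝ)..x, p t) + q 0, fun x => ∫ t in (0 : ℝ)..x, r t,
    (hp.convexOn_univ_integral 0).add_const (q 0), hr.convexOn_univ_integral 0, fun x => ?_⟩
  have hip : IntervalIntegrable p MeasureTheory.volume 0 x := hp.intervalIntegrable
  have hir : IntervalIntegrable r MeasureTheory.volume 0 x := hr.intervalIntegrable
  have hftc : ∫ t in (0 : ℝ)..x, deriv q t = q x - q 0 :=
    intervalIntegral.integral_deriv_eq_sub (fun t _ => hq t) (hpr ▸ hip.sub hir)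
  have hsub : ∫ t in (0 : ℝ)..x, deriv q t = (∫ t in (0 : ℝ)..x, p t) - ∫ t in (0 : ℝ)..x, r t := by
    rw [hpr]
    exact intervalIntegral.integral_sub hip hir
  linarith
end

section
/- Let f : (0,∞) → (0,∞) be a measurable function with f(2^{-n}) = n·2^n for every integer n ≥ 1, and let m̃ be the measure on the Borel sets of (0,∞) with density f with respect to the measure λ + ∑_{n=1}^∞ n^{-2}·δ_{2^{-n}}, where λ is Lebesgue measure on (0,∞) and δ_y denotes the Dirac measure at y. Then for every ε ∈ (0,∞), ∫_{(0,ε)} x dm̃(x) = ∞. -/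
open MeasureTheory Set
open scoped ENNReal

/-- Let `f` be measurable with `f (2⁻ⁿ) = n·2ⁿ` for `n ≥ 1`, and let `m̃` be
the measure with density `f` with respect to `λ|_{(0,∞)} + ∑_{n≥1} n⁻² δ_{2⁻ⁿ}`. Then
`∫_{(0,ε)} x dm̃(x) = ∞` for every `ε > 0`. -/
theorem speed_measure_makes_origin_inaccessible
    (f : ℝ → ℝ) (hf_meas : Measurable f)
    (hf_dyadic : ∀ n : ℕ, 1 ≤ n → f ((2 : ℝ) ^ (-(n : ℤ))) = (n : ℝ) * 2 ^ n)
    (μ : Measure ℝ)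
    (hμ : μ = volume.restrict (Ioi (0 : ℝ)) +
      Measure.sum (fun n : ℕ =>
        ((((n : ℝ≥0∞) + 1) ^ 2)⁻¹) • Measure.dirac ((2 : ℝ) ^ (-((n : ℤ) + 1)))))
    (mtilde : Measure ℝ)
    (hm : mtilde = μ.withDensity (fun x => ENNReal.ofReal (f x))) :
    ∀ ε : ℝ, 0 < ε → ∫⁻ x in Ioo (0 : ℝ) ε, ENNReal.ofReal x ∂mtilde = ∞ := by
  intro ε hε
  obtain ⟨N, hN⟩ := exists_pow_lt_of_lt_one hε (by norm_num : (2 : ℝ)⁻¹ < 1)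
  set g : ℝ → ℝ≥0∞ := fun x => ENNReal.ofReal (f x) * ENNReal.ofReal x with hg
  have hg_meas : Measurable ((Ioo (0 : ℝ) ε).indicator g) :=
    (hf_meas.ennreal_ofReal.mul ENNReal.measurable_ofReal).indicator measurableSet_Ioo
  have hterm : ∀ n : ℕ, ENNReal.ofReal (1 / ((n + (N + 1) : ℕ) : ℝ)) ≤
      ((((n + N : ℕ) : ℝ≥0∞) + 1) ^ 2)⁻¹ *
        (Ioo (0 : ℝ) ε).indicator g ((2 : ℝ) ^ (-(((n + N : ℕ) : ℤ) + 1))) := by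
    intro n
    set k : ℕ := n + N with hk
    have hpow : (2 : ℝ) ^ (-((k : ℤ) + 1)) = (2 : ℝ)⁻¹ ^ (k + 1) := by
      rw [zpow_neg, inv_pow, ← zpow_natCast]
      push_cast
      rfl
    have hmem : (2 : ℝ) ^ (-((k : ℤ) + 1)) ∈ Ioo (0 : ℝ) ε := by
      refine ⟨by positivity, ?_⟩
      rw [hpow]
      exact (pow_le_pow_of_le_one (by norm_num) (by norm_num) (by omega)).trans_lt hN
    have hval : f ((2 : ℝ) ^ (-((k : ℤ) + 1))) = ((k : ℝ) + 1) * 2 ^ (k + 1) := by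
      have := hf_dyadic (k + 1) (by omega)
      push_cast at this
      exact this
    have hcast : ((k : ℝ≥0∞) + 1) = ENNReal.ofReal ((k : ℝ) + 1) := by
      rw [ENNReal.ofReal_add (by positivity) zero_le_one]
      simp
    rw [indicator_of_mem hmem, hg]
    simp only
    rw [hval, hpow, hcast, ← ENNReal.ofReal_pow (by positivity),
      ← ENNReal.ofReal_inv_of_pos (by positivity), ← ENNReal.ofReal_mul (by positivity),
      ← ENNReal.ofReal_mul (by positivity)]
    apply ENNReal.ofReal_le_ofReal
    apply le_of_eq
    rw [← add_assoc n N 1, ← hk]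
    push_cast
    rw [inv_pow]
    field_simp
  have hdiv : ∑' n : ℕ, ENNReal.ofReal (1 / ((n + (N + 1) : ℕ) : ℝ)) = ∞ := by
    by_contra h
    have hs := ENNReal.summable_toReal h
    simp_rw [ENNReal.toReal_ofReal (one_div_nonneg.2 (Nat.cast_nonneg _))] at hs
    exact Real.not_summable_one_div_natCast
      ((summable_nat_add_iff (f := fun n : ℕ => 1 / (n : ℝ)) (N + 1)).1 hs)
  rw [hm, setLIntegral_withDensity_eq_setLIntegral_mul μ hf_meas.ennreal_ofReal
    ENNReal.measurable_ofReal measurableSet_Ioo, ← lintegral_indicator measurableSet_Ioo,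
    hμ, lintegral_add_measure, lintegral_sum_measure]
  simp_rw [lintegral_smul_measure]
  refine top_unique (le_trans ?_ le_add_self)
  rw [← hdiv]
  refine (ENNReal.tsum_le_tsum hterm).trans ?_
  refine le_trans ?_ (ENNReal.tsum_comp_le_tsum_of_injective (add_left_injective N) _)
  refine ENNReal.tsum_le_tsum fun n => ?_
  exact le_of_eq (congrArg _ (lintegral_dirac' _ hg_meas).symm)
end
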